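/- Let G, H, and K be games over a poset A, and suppose G and K have parity. Then: (A) if G ≤ H ≤ K, then G and K have matching parity (both even or both odd); (B) if G ≤ H ◁ K, then G and K have mismatching parity; (C) if G ◁ H ≤ K, then G and K have mismatching parity. In particular, if G ≤ H and both have parity then they have matching parity, and if G ◁ H and both have parity then they have mismatching parity. -/

import Mathlib

/-- Games over a poset `α`: atomic games `[a]` for `a : α`, and composite games
`⟨L|R⟩` given by nonempty families of left and right options. -/
inductive Game (α : Type) : Type 1 where
  | atom : α → Game α
  | comp : (ι κ : Type) → (ι → Game α) → (κ → Game α) → Nonempty ι → Nonempty κ → Game α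

namespace Game

variable {α β : Type}

/-- `G'` is a left option of the game. -/
def IsLeftOption (G' : Game α) : Game α → Prop
  | atom _ => False
  | comp _ _ L _ _ _ => ∃ i, L i = G'

/-- `G'` is a right option of the game. -/
def IsRightOption (G' : Game α) : Game α → Prop
  | atom _ => False
  | comp _ _ _ R _ _ => ∃ k, R k = G'

/-- `G'` is an option of `G`. -/
def IsOption (G' G : Game α) : Prop := IsLeftOption G' G ∨ IsRightOption G' G

/-- A game is composite if it is not atomic. -/
def IsComposite : Game α → Prop
  | atom _ => False
  | comp _ _ _ _ _ _ => True

/-- `G'` is a follower of `G`: `G` itself, an option of `G`, or recursively a follower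
of an option of `G`. -/
def IsFollower (G' G : Game α) : Prop := Relation.ReflTransGen IsOption G' G

/-- The dual game: Left and Right switch sides; it is a game over the opposite poset. -/
def dual : Game α → Game αᵒᵈ
  | atom a => atom (OrderDual.toDual a)
  | comp ι κ L R hι hκ => comp κ ι (fun k => (R k).dual) (fun i => (L i).dual) hκ hι

/-- The image of a game under a (monotone) function applied to atoms. -/
def map (f : α → β) : Game α → Game β
  | atom a => atom (f a)
  | comp ι κ L R hι hκ => comp ι κ (fun i => (L i).map f) (fun k => (R k).map f) hι hκ

/-- The (disjunctive) sum of a game over `α` and a game over `β`, a game over `α × β`. -/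
noncomputable def add : Game α → Game β → Game (α × β) := by
  intro G
  induction G with
  | atom g =>
    intro H
    induction H with
    | atom h => exact atom (g, h)
    | comp ι κ L R hι hκ IHL IHR => exact comp ι κ IHL IHR hι hκ
  | comp ι κ L R hι hκ IHL IHR =>
    intro H
    induction H with
    | atom h => exact comp ι κ (fun i => IHL i (atom h)) (fun k => IHR k (atom h)) hι hκ
    | comp ι' κ' L' R' hι' hκ' IHL' IHR' =>
      exact comp (ι ⊕ ι') (κ ⊕ κ')
        (Sum.elim (fun i => IHL i (comp ι' κ' L' R' hι' hκ')) IHL')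
        (Sum.elim (fun k => IHR k (comp ι' κ' L' R' hι' hκ')) IHR')
        (hι.elim fun i => ⟨Sum.inl i⟩) (hκ.elim fun k => ⟨Sum.inl k⟩)

mutual
/-- Left has a first player winning strategy in a game over the boolean poset:
either the game is the atom `⊤`, or some left option has a second player
winning strategy for Left. -/
inductive LeftWinsFirst : Game Bool → Prop where
  | atom_top : LeftWinsFirst (atom true)
  | move {G G' : Game Bool} : IsLeftOption G' G → LeftWinsSecond G' → LeftWinsFirst G

/-- Left has a second player winning strategy in a game over the boolean poset:
every right option has a first player winning strategy for Left, and if the game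
is atomic it is the atom `⊤`. -/
inductive LeftWinsSecond : Game Bool → Prop where
  | mk {G : Game Bool} : (∀ G', IsRightOption G' G → LeftWinsFirst G') →
      (∀ b, G = atom b → b = true) → LeftWinsSecond G
end

mutual
/-- A game is even if all of its options are odd (atomic games are even). -/
inductive Even {α : Type} : Game α → Prop where
  | mk {G : Game α} : (∀ G', IsOption G' G → Odd G') → Even G

/-- A game is odd if it is composite and all of its options are even. -/
inductive Odd {α : Type} : Game α → Prop where
  | mk {G : Game α} : G.IsComposite → (∀ G', IsOption G' G → Even G') → Odd G
end

/-- A game has parity if it is even or odd. -/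
def HasParity (G : Game α) : Prop := Even G ∨ Odd G

/-- `G` and `H` have matching parity (both even or both odd). -/
def MatchingParity (G H : Game α) : Prop := (Even G ∧ Even H) ∨ (Odd G ∧ Odd H)

/-- `G` and `H` have mismatching parity (one even, the other odd). -/
def MismatchParity (G H : Game α) : Prop := (Even G ∧ Odd H) ∨ (Odd G ∧ Even H)

mutual
/-- The intrinsic order `G ≤ H` on games over a poset: every left option `G^L` of `G`
satisfies `G^L ◁ H`, every right option `H^R` of `H` satisfies `G ◁ H^R`, and if
both games are atoms `[g]`, `[h]` then `g ≤ h`. -/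
inductive Le {α : Type} [PartialOrder α] : Game α → Game α → Prop where
  | mk {G H : Game α} :
      (∀ G', IsLeftOption G' G → Tri G' H) →
      (∀ H', IsRightOption H' H → Tri G H') →
      (∀ g h, G = atom g → H = atom h → g ≤ h) →
      Le G H

/-- The intrinsic relation `G ◁ H` on games over a poset: some right option `G^R` of `G`
satisfies `G^R ≤ H`, or some left option `H^L` of `H` satisfies `G ≤ H^L`. -/
inductive Tri {α : Type} [PartialOrder α] : Game α → Game α → Prop where
  | inr {G H G' : Game α} : IsRightOption G' G → Le G' H → Tri G H
  | inl {G H H' : Game α} : IsLeftOption H' H → Le G H' → Tri G H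
end

/-- The comparison game `λ(Gᵒᵖ + H)`, a game over the boolean poset, where
`λ : αᵒᵈ × α → 𝔹` is the monotone map with `λ(xᵒᵖ, y) = ⊤` iff `x ≤ y`. -/
noncomputable def comparison [PartialOrder α] (G H : Game α) : Game Bool :=
  map (fun p : αᵒᵈ × α => @decide (OrderDual.ofDual p.1 ≤ p.2) (Classical.propDecidable _))
    (G.dual.add H)

/-- A game is locally premotive if Left has a first player winning strategy in
the comparison game `λ(Gᵒᵖ + G)`. -/
def LocallyPremotive [PartialOrder α] (G : Game α) : Prop := LeftWinsFirst (comparison G G)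

/-- A game is premotive if it and all of its followers are locally premotive. -/
def Premotive [PartialOrder α] (G : Game α) : Prop :=
  ∀ G', IsFollower G' G → LocallyPremotive G'

/-- The game `* = ⟨0|0⟩` over the one-element poset. -/
def star : Game Unit := comp Unit Unit (fun _ => atom ()) (fun _ => atom ()) ⟨()⟩ ⟨()⟩

/-- `G + *`, identified with a game over `α` via the isomorphism `α × 1 ≅ α`. -/
noncomputable def addStar (G : Game α) : Game α := map Prod.fst (G.add star)

/-- A game is locally `*`-antimonotone if `G^L + * ≤ G ≤ G^R + *` for all left and
right options `G^L`, `G^R`. -/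
def LocallyStarAnti [PartialOrder α] (G : Game α) : Prop :=
  (∀ G', IsLeftOption G' G → Le G'.addStar G) ∧ (∀ G', IsRightOption G' G → Le G G'.addStar)

/-- A game is `*`-antimonotone if it and all of its followers are locally
`*`-antimonotone. -/
def StarAnti [PartialOrder α] (G : Game α) : Prop :=
  ∀ G', IsFollower G' G → LocallyStarAnti G'

/-- `ε(G + X)`: the game `G` over `α` embedded in a context `X`, a game over the poset
`[α, 𝔹]` of monotone functions `α → 𝔹`, via the application map `ε(a, f) = f a`. -/
noncomputable def ctxSum [PartialOrder α] (G : Game α) (X : Game (α →o Bool)) : Game Bool :=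
  map (fun p : α × (α →o Bool) => p.2 p.1) (G.add X)

/-- The outcome `(o_L(G), o_R(G)) ∈ 𝔹 × 𝔹` of a game over the boolean poset:
`o_L(G) = ⊤` iff Left has a first player winning strategy and `o_R(G) = ⊤` iff
Left has a second player winning strategy. -/
noncomputable def outcome (G : Game Bool) : Bool × Bool :=
  (@decide (LeftWinsFirst G) (Classical.propDecidable _),
   @decide (LeftWinsSecond G) (Classical.propDecidable _))

/-- The contextual order `G ≤_c H`: `o(G+X) ≤ o(H+X)` for every context `X`. -/
def ContextualLe [PartialOrder α] (G H : Game α) : Prop :=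
  ∀ X : Game (α →o Bool), outcome (ctxSum G X) ≤ outcome (ctxSum H X)

/-- The contextual relation `G ◁_c H`: `o_R(G+X) ≤ o_L(H+X)` for every context `X`. -/
def ContextualTri [PartialOrder α] (G H : Game α) : Prop :=
  ∀ X : Game (α →o Bool), (outcome (ctxSum G X)).2 ≤ (outcome (ctxSum H X)).1

/-- Two games are identical when they are equal as set-based games: both are the same
atom, or both are composite with identical sets of left options and identical sets of
right options (recursively). -/
def Identical : Game α → Game α → Prop
  | atom a, atom b => a = b
  | comp _ _ L R _ _, comp _ _ L' R' _ _ =>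
      ((∀ i, ∃ i', Identical (L i) (L' i')) ∧ (∀ i', ∃ i, Identical (L i) (L' i'))) ∧
      ((∀ k, ∃ k', Identical (R k) (R' k')) ∧ (∀ k', ∃ k, Identical (R k) (R' k')))
  | _, _ => False

theorem optInd {P : Game α → Prop} (h : ∀ G, (∀ G', IsOption G' G → P G') → P G) :
    ∀ G, P G := by
  intro G
  induction G with
  | atom a => exact h _ (fun G' hG => by rcases hG with hG | hG <;> exact hG.elim)
  | comp ι κ L R hι hκ ihL ihR =>
    refine h _ (fun G' hG => ?_)
    rcases hG with ⟨i, rfl⟩ | ⟨i, rfl⟩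
    · exact ihL i
    · exact ihR i

theorem even_opt {G G' : Game α} (h : Even G) (o : IsOption G' G) : Odd G' := by
  cases h with
  | mk h => exact h _ o

theorem odd_opt {G G' : Game α} (h : Odd G) (o : IsOption G' G) : Even G' := by
  cases h with
  | mk _ h => exact h _ o

theorem atom_or (G : Game α) : (∃ a, G = atom a) ∨
    ((∃ G', IsLeftOption G' G) ∧ ∃ G', IsRightOption G' G) := by
  cases G with
  | atom a => exact Or.inl ⟨a, rfl⟩
  | comp ι κ L R hι hκ =>
    exact Or.inr ⟨⟨_, ⟨hι.some, rfl⟩⟩, ⟨_, ⟨hκ.some, rfl⟩⟩⟩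

theorem even_atom (a : α) : Even (atom a) :=
  Even.mk (fun _ h => by rcases h with h | h <;> exact h.elim)

theorem not_odd_atom (a : α) : ¬ Odd (atom a) := by
  intro h
  cases h with
  | mk c _ => exact c

theorem not_even_odd : ∀ G : Game α, ¬ (Even G ∧ Odd G) := by
  refine optInd (fun G ih => ?_)
  rintro ⟨he, ho⟩
  rcases atom_or G with ⟨a, rfl⟩ | ⟨⟨G', hG⟩, _⟩
  · exact not_odd_atom a ho
  · exact ih G' (Or.inl hG) ⟨odd_opt ho (Or.inl hG), even_opt he (Or.inl hG)⟩

theorem hasParity_opt {G G' : Game α} (h : HasParity G) (o : IsOption G' G) : HasParity G' :=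
  h.elim (fun h => Or.inr (even_opt h o)) (fun h => Or.inl (odd_opt h o))

theorem flipL_match {G G' K : Game α} (h : HasParity G) (o : IsOption G' G)
    (m : MismatchParity G' K) : MatchingParity G K := by
  have n := not_even_odd G'
  have a : Even G → Odd G' := fun h => even_opt h o
  have b : Odd G → Even G' := fun h => odd_opt h o
  unfold HasParity at h
  unfold MismatchParity at m
  unfold MatchingParity
  tauto

theorem flipL_mis {G G' K : Game α} (h : HasParity G) (o : IsOption G' G)
    (m : MatchingParity G' K) : MismatchParity G K := by
  have n := not_even_odd G'
  have a : Even G → Odd G' := fun h => even_opt h o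
  have b : Odd G → Even G' := fun h => odd_opt h o
  unfold HasParity at h
  unfold MatchingParity at m
  unfold MismatchParity
  tauto

theorem match_symm {G K : Game α} (m : MatchingParity G K) : MatchingParity K G := by
  unfold MatchingParity at *
  tauto

theorem mis_symm {G K : Game α} (m : MismatchParity G K) : MismatchParity K G := by
  unfold MismatchParity at *
  tauto

theorem le_left [PartialOrder α] {G H G' : Game α} (h : Le G H) (o : IsLeftOption G' G) :
    Tri G' H := by
  cases h with
  | mk h _ _ => exact h _ o

theorem le_right [PartialOrder α] {G H H' : Game α} (h : Le G H) (o : IsRightOption H' H) :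
    Tri G H' := by
  cases h with
  | mk _ h _ => exact h _ o

theorem le_self [PartialOrder α] : ∀ G : Game α, Le G G := by
  refine optInd (fun G ih => ?_)
  refine Le.mk (fun G' o => Tri.inl o (ih _ (Or.inl o)))
    (fun G' o => Tri.inr o (ih _ (Or.inr o))) ?_
  rintro g h rfl e
  cases e
  exact le_refl _

theorem parity_main [PartialOrder α] : ∀ G H K : Game α, HasParity G → HasParity K →
      ((Le G H → Le H K → MatchingParity G K) ∧
       (Le G H → Tri H K → MismatchParity G K) ∧
       (Tri G H → Le H K → MismatchParity G K)) := by
  refine optInd (fun G ihG => ?_)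
  refine optInd (fun H ihH => ?_)
  refine optInd (fun K ihK => ?_)
  intro pG pK
  refine ⟨fun h1 h2 => ?_, fun h1 h2 => ?_, fun h1 h2 => ?_⟩
  · rcases atom_or G with ⟨g, rfl⟩ | ⟨⟨G', o⟩, _⟩
    · rcases atom_or K with ⟨k, rfl⟩ | ⟨_, ⟨K', o⟩⟩
      · exact Or.inl ⟨even_atom g, even_atom k⟩
      · have p := hasParity_opt pK (Or.inr o)
        exact match_symm (flipL_match pK (Or.inr o)
          (mis_symm ((ihK K' (Or.inr o) pG p).2.1 h1 (le_right h2 o))))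
    · have p := hasParity_opt pG (Or.inl o)
      exact flipL_match pG (Or.inl o)
        ((ihG G' (Or.inl o) H K p pK).2.2 (le_left h1 o) h2)
  · cases h2 with
    | inr o h => exact (ihH _ (Or.inr o) K pG pK).2.2 (le_right h1 o) h
    | inl o h =>
      exact mis_symm (flipL_mis pK (Or.inl o) (match_symm
        ((ihK _ (Or.inl o) pG (hasParity_opt pK (Or.inl o))).1 h1 h)))
  · cases h1 with
    | inr o h =>
      exact flipL_mis pG (Or.inr o)
        ((ihG _ (Or.inr o) H K (hasParity_opt pG (Or.inr o)) pK).1 h h2)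
    | inl o h => exact (ihH _ (Or.inl o) K pG pK).2.1 h (le_left h2 o)

/-- Parity and the intrinsic order: if `G` and `K` have parity then
`G ≤ H ≤ K` forces matching parity, while `G ≤ H ◁ K` and `G ◁ H ≤ K` force
mismatching parity; in particular `G ≤ H` forces matching parity and `G ◁ H`
forces mismatching parity for games with parity. -/
theorem parity_and_order {α : Type} [PartialOrder α] :
    (∀ G H K : Game α, HasParity G → HasParity K →
      ((Le G H → Le H K → MatchingParity G K) ∧
       (Le G H → Tri H K → MismatchParity G K) ∧
       (Tri G H → Le H K → MismatchParity G K))) ∧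
    (∀ G H : Game α, HasParity G → HasParity H →
      ((Le G H → MatchingParity G H) ∧ (Tri G H → MismatchParity G H))) := by
  refine ⟨parity_main, fun G H pG pH => ⟨fun h => ?_, fun h => ?_⟩⟩
  · exact (parity_main G G H pG pH).1 (le_self G) h
  · exact (parity_main G G H pG pH).2.1 (le_self G) h

end Game
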